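/- arXiv:1811.12575 — 2 statements merged into one kernel-verified Lean document; each statement's English description precedes it below -/
import Mathlib

section
/- Let p : ℕ → ℝ be a nonincreasing probability sequence with p 0 ≤ 2/3, and let π : ℕ × ℕ → ℕ be any bijection. Then the Bhattacharyya (fidelity) coefficient between the rearranged distribution and the product distribution satisfies ∑'_{(j,k)} √(p (π (j,k)) · p j · p k) ≤ √(1 − (2/9)²), and in particular this sum is strictly less than 39/40. -/
open Finset in
/-- A Bhattacharyya coefficient is bounded through the discrepancy of the two distributions on any
finite event. -/
theorem tsum_sqrt_mul_le_sqrt_one_sub_sq {ι : Type*} {f g : ι → ℝ}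
    (hf : ∀ i, 0 ≤ f i) (hg : ∀ i, 0 ≤ g i) (hf1 : HasSum f 1) (hg1 : HasSum g 1)
    (T : Finset ι) :
    ∑' i, √(f i * g i) ≤ √(1 - (∑ i ∈ T, f i - ∑ i ∈ T, g i) ^ 2) := by
  classical
  have compl_le {h : ι → ℝ} (hh : ∀ i, 0 ≤ h i) (hh1 : HasSum h 1) (s : Finset ι) :
      ∑ i ∈ s \ T, h i ≤ 1 - ∑ i ∈ T, h i := by
    have := sum_le_hasSum (s \ T ∪ T) (fun i _ => hh i) hh1
    rw [sum_union sdiff_disjoint] at this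
    linarith
  have sum_le (s : Finset ι) :
      ∑ i ∈ s, √(f i * g i) ≤ √(∑ i ∈ s, f i) * √(∑ i ∈ s, g i) := by
    simpa only [Real.sqrt_mul (hf _)] using Real.sum_sqrt_mul_sqrt_le s hf hg
  have hx0 : 0 ≤ ∑ i ∈ T, f i := sum_nonneg fun i _ => hf i
  have hy0 : 0 ≤ ∑ i ∈ T, g i := sum_nonneg fun i _ => hg i
  have hx1 : ∑ i ∈ T, f i ≤ 1 := sum_le_hasSum T (fun i _ => hf i) hf1
  have hy1 : ∑ i ∈ T, g i ≤ 1 := sum_le_hasSum T (fun i _ => hg i) hg1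
  refine Real.tsum_le_of_sum_le (fun i => Real.sqrt_nonneg _) fun s => ?_
  have hinter : ∑ i ∈ s ∩ T, √(f i * g i) ≤ √(∑ i ∈ T, f i) * √(∑ i ∈ T, g i) :=
    (sum_le_sum_of_subset_of_nonneg inter_subset_right fun i _ _ => Real.sqrt_nonneg _).trans
      (sum_le T)
  have hdiff : ∑ i ∈ s \ T, √(f i * g i) ≤
      √(1 - ∑ i ∈ T, f i) * √(1 - ∑ i ∈ T, g i) :=
    (sum_le _).trans (mul_le_mul (Real.sqrt_le_sqrt (compl_le hf hf1 s))
      (Real.sqrt_le_sqrt (compl_le hg hg1 s)) (Real.sqrt_nonneg _) (Real.sqrt_nonneg _))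
  rw [← sum_inter_add_sum_sdiff s T]
  refine (add_le_add hinter hdiff).trans (Real.le_sqrt_of_sq_le ?_)
  generalize ∑ i ∈ T, f i = x at *
  generalize ∑ i ∈ T, g i = y at *
  have h₁ := Real.sq_sqrt hx0
  have h₂ := Real.sq_sqrt hy0
  have h₃ := Real.sq_sqrt (sub_nonneg.2 hx1)
  have h₄ := Real.sq_sqrt (sub_nonneg.2 hy1)
  have hamgm := two_mul_le_add_sq (√x * √(1 - x)) (√y * √(1 - y))
  rw [mul_pow, mul_pow, h₁, h₂, h₃, h₄] at hamgm
  rw [add_sq, mul_pow, mul_pow, h₁, h₂, h₃, h₄]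
  linarith

open Finset in
theorem Antitone.sum_le_sum_range_card {p : ℕ → ℝ} (hp : Antitone p) (A : Finset ℕ) :
    ∑ i ∈ A, p i ≤ ∑ i ∈ range #A, p i := by
  induction A using Finset.induction_on_max with
  | empty => simp
  | insert m s hm ih =>
    have hms : m ∉ s := fun h => (hm m h).false
    have hcard : #s ≤ m := by
      simpa using card_le_card (fun i hi => mem_range.2 (hm i hi) : s ⊆ range m)
    rw [sum_insert hms, card_insert_of_notMem hms, sum_range_succ]
    linarith [hp hcard]

open Finset in
/-- The mass of `n` pairs under a product distribution is at most the mass of the square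
`range n ×ˢ range n`. -/
theorem Antitone.sum_mul_le_sq_sum_range {p : ℕ → ℝ} (hp : Antitone p) (h0 : ∀ i, 0 ≤ p i)
    (T : Finset (ℕ × ℕ)) :
    ∑ i ∈ T, p i.1 * p i.2 ≤ (∑ i ∈ range #T, p i) ^ 2 := by
  have image_le (φ : ℕ × ℕ → ℕ) : ∑ i ∈ T.image φ, p i ≤ ∑ i ∈ range #T, p i :=
    (hp.sum_le_sum_range_card _).trans <|
      sum_le_sum_of_subset_of_nonneg (range_mono card_image_le) fun i _ _ => h0 i
  calc ∑ i ∈ T, p i.1 * p i.2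
      ≤ ∑ i ∈ T.image Prod.fst ×ˢ T.image Prod.snd, p i.1 * p i.2 :=
        sum_le_sum_of_subset_of_nonneg subset_product fun i _ _ => mul_nonneg (h0 _) (h0 _)
    _ = (∑ i ∈ T.image Prod.fst, p i) * ∑ i ∈ T.image Prod.snd, p i := by
        rw [sum_mul_sum, sum_product]
    _ ≤ (∑ i ∈ range #T, p i) ^ 2 := by
        rw [sq]
        exact mul_le_mul (image_le _) (image_le _) (sum_nonneg fun i _ => h0 i)
          (sum_nonneg fun i _ => h0 i)

open Finset in
theorem Antitone.exists_sum_range_mem_Icc {p : ℕ → ℝ} (hp : Antitone p) (hp1 : HasSum p 1)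
    (h0 : p 0 ≤ 2 / 3) :
    ∃ n, ∑ i ∈ range n, p i ∈ Set.Icc (1 / 3 : ℝ) (2 / 3) := by
  classical
  have hex : ∃ n, 1 / 3 ≤ ∑ i ∈ range n, p i :=
    (hp1.tendsto_sum_nat.eventually (eventually_ge_nhds (by norm_num))).exists
  refine ⟨Nat.find hex, Nat.find_spec hex, ?_⟩
  rcases hn : Nat.find hex with _ | n
  · norm_num
  · have hlt := not_le.1 (Nat.find_min hex (m := n) (by omega))
    rw [sum_range_succ]
    rcases n with _ | n
    · simpa using h0
    · have hfirst := not_le.1 (Nat.find_min hex (m := 1) (by omega))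
      rw [sum_range_one] at hfirst
      linarith [hp (Nat.zero_le (n + 1))]

/-- For a nonincreasing probability sequence `p` with `p 0 ≤ 2/3` and any
bijection `π : ℕ × ℕ → ℕ`, the Bhattacharyya (fidelity) coefficient between the
rearranged distribution and the product distribution is at most `√(1 - (2/9)²)`,
and in particular strictly less than `39/40`. -/
theorem self_embezzlement_fidelity_upper_bound
    (p : ℕ → ℝ)
    (hnonneg : ∀ k, 0 ≤ p (k + 1))
    (hmono : ∀ k, p (k + 1) ≤ p k)
    (hsum : Summable p)
    (htot : ∑' k, p k = 1)
    (h0 : p 0 ≤ 2 / 3)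
    (π : ℕ × ℕ → ℕ) (hπ : Function.Bijective π) :
    (∑' jk : ℕ × ℕ, Real.sqrt (p (π jk) * (p jk.1 * p jk.2)))
      ≤ Real.sqrt (1 - (2 / 9) ^ 2) ∧
    (∑' jk : ℕ × ℕ, Real.sqrt (p (π jk) * (p jk.1 * p jk.2))) < 39 / 40 := by
  have hp : Antitone p := antitone_nat_of_succ_le hmono
  have hp0 (k : ℕ) : 0 ≤ p k := (hnonneg k).trans (hmono k)
  have hp1 : HasSum p 1 := htot ▸ hsum.hasSum
  have hprod : HasSum (fun jk : ℕ × ℕ => p jk.1 * p jk.2) 1 := by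
    simpa using hp1.mul hp1 (hsum.mul_of_nonneg hsum hp0 hp0)
  let e := Equiv.ofBijective π hπ
  have hperm : HasSum (fun jk => p (π jk)) 1 := e.hasSum_iff.2 hp1
  obtain ⟨n, hn₁, hn₂⟩ := hp.exists_sum_range_mem_Icc hp1 h0
  let T := (Finset.range n).map e.symm.toEmbedding
  have hT : ∑ jk ∈ T, p (π jk) = ∑ i ∈ Finset.range n, p i := by
    rw [Finset.sum_map]
    exact Finset.sum_congr rfl fun i _ => congrArg p (e.apply_symm_apply i)
  have hTprod := hp.sum_mul_le_sq_sum_range hp0 T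
  rw [Finset.card_map, Finset.card_range] at hTprod
  have hmain := tsum_sqrt_mul_le_sqrt_one_sub_sq (fun jk => hp0 (π jk))
    (fun jk => mul_nonneg (hp0 jk.1) (hp0 jk.2)) hperm hprod T
  rw [hT] at hmain
  have hgap : 2 / 9 ≤ ∑ i ∈ Finset.range n, p i - ∑ jk ∈ T, p jk.1 * p jk.2 := by
    nlinarith
  have hle := hmain.trans (Real.sqrt_le_sqrt
    (sub_le_sub_left (pow_le_pow_left₀ (by norm_num) hgap 2) 1))
  exact ⟨hle, hle.trans_lt ((Real.sqrt_lt' (by norm_num)).2 (by norm_num))⟩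
end

section
/- Let p : ℕ → ℝ be nonincreasing with p k ≥ 0 for all k and summable, and let g : ℕ → ℝ satisfy g k ≥ 0 for all k and ∑' k, g k ≤ 1. For every m ≥ 1 and every finite set T ⊆ ℕ × ℕ × ℕ with |T| ≤ m, one has ∑_{(i,j,k) ∈ T} p i · p j · g k ≤ (∑_{k=0}^{m−1} p k)². -/
theorem Antitone.sum_le_sum_range_of_card_le {p : ℕ → ℝ} (hp : Antitone p)
    (hnonneg : ∀ k, 0 ≤ p k) {m : ℕ} {S : Finset ℕ} (hS : S.card ≤ m) :
    ∑ k ∈ S, p k ≤ ∑ k ∈ Finset.range m, p k := by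
  rw [← Finset.sum_sdiff_le_sum_sdiff]
  have hcard : (S \ Finset.range m).card ≤ (Finset.range m \ S).card :=
    Finset.card_sdiff_le_card_sdiff_iff.2 (by simpa using hS)
  calc ∑ k ∈ S \ Finset.range m, p k
      ≤ (S \ Finset.range m).card • p m :=
        Finset.sum_le_card_nsmul _ _ _ fun k hk => hp (by simp at hk; exact hk.2)
    _ ≤ (Finset.range m \ S).card • p m := nsmul_le_nsmul_left (hnonneg m) hcard
    _ ≤ ∑ k ∈ Finset.range m \ S, p k :=
        Finset.card_nsmul_le_sum _ _ _ fun k hk => hp (by simp at hk; exact hk.1.le)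

/-- For a nonnegative, nonincreasing, summable sequence `p` and a
nonnegative sequence `g` with total sum at most 1, every `m ≥ 1`, and every finite
set `T ⊆ ℕ × ℕ × ℕ` with `|T| ≤ m`, the sum of `p i * p j * g k` over `T` is at most
`(∑_{k<m} p k)²`. -/
theorem product_array_with_gamma_finset_sum_le_sq
    (p : ℕ → ℝ)
    (hnonneg : ∀ k, 0 ≤ p k)
    (hmono : ∀ k, p (k + 1) ≤ p k)
    (hsum : Summable p)
    (g : ℕ → ℝ) (hg : ∀ k, 0 ≤ g k) (hgs : Summable g) (hgtot : ∑' k, g k ≤ 1)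
    (m : ℕ) (hm : 1 ≤ m)
    (T : Finset (ℕ × ℕ × ℕ)) (hT : T.card ≤ m) :
    ∑ x ∈ T, p x.1 * p x.2.1 * g x.2.2 ≤ (∑ k ∈ Finset.range m, p k) ^ 2 := by
  classical
  have hp : Antitone p := antitone_nat_of_succ_le hmono
  have hsub : T ⊆ T.image (fun x => x.1) ×ˢ T.image (fun x => x.2.1) ×ˢ
      T.image (fun x => x.2.2) := fun x hx => by
    simp only [Finset.mem_product]
    exact ⟨Finset.mem_image_of_mem _ hx, Finset.mem_image_of_mem (fun x => x.2.1) hx,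
      Finset.mem_image_of_mem (fun x => x.2.2) hx⟩
  have hproj (f : ℕ × ℕ × ℕ → ℕ) :
      ∑ i ∈ T.image f, p i ≤ ∑ k ∈ Finset.range m, p k :=
    hp.sum_le_sum_range_of_card_le hnonneg (Finset.card_image_le.trans hT)
  have hsum_g : ∑ k ∈ T.image (fun x => x.2.2), g k ≤ 1 :=
    (hgs.sum_le_tsum _ fun k _ => hg k).trans hgtot
  have hpos : 0 ≤ ∑ k ∈ Finset.range m, p k := Finset.sum_nonneg fun k _ => hnonneg k
  calc ∑ x ∈ T, p x.1 * p x.2.1 * g x.2.2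
      ≤ ∑ x ∈ T.image (fun x => x.1) ×ˢ T.image (fun x => x.2.1) ×ˢ
          T.image (fun x => x.2.2), p x.1 * p x.2.1 * g x.2.2 :=
        Finset.sum_le_sum_of_subset_of_nonneg hsub fun x _ _ =>
          mul_nonneg (mul_nonneg (hnonneg _) (hnonneg _)) (hg _)
    _ = (∑ i ∈ T.image (fun x => x.1), p i) * ((∑ j ∈ T.image (fun x => x.2.1), p j) *
          ∑ k ∈ T.image (fun x => x.2.2), g k) := by
        simp only [Finset.sum_product, Finset.sum_mul_sum]
        simp only [Finset.mul_sum, mul_assoc]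
    _ ≤ (∑ k ∈ Finset.range m, p k) * ((∑ k ∈ Finset.range m, p k) * 1) :=
        mul_le_mul (hproj _)
          (mul_le_mul (hproj _) hsum_g (Finset.sum_nonneg fun k _ => hg k) hpos)
          (mul_nonneg (Finset.sum_nonneg fun k _ => hnonneg k)
            (Finset.sum_nonneg fun k _ => hg k)) hpos
    _ = (∑ k ∈ Finset.range m, p k) ^ 2 := by ring
end
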